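/- For any stably compact formal topology S, the patch of S is isomorphic to the patch of its de Groot dual: Patch(S) ≅ Patch(S^d). -/

import Mathlib

noncomputable section
open Classical

universe u v

namespace FTP

/-! ### Basic covers -/

/-- `U ◁ V` : every element of `U` is covered by `V`. -/
def covS {S : Type*} (cov : S → Set S → Prop) (U V : Set S) : Prop :=
  ∀ a ∈ U, cov a V

/-- A basic cover: reflexivity and transitivity. -/
def IsBasicCover {S : Type*} (cov : S → Set S → Prop) : Prop :=
  (∀ (a : S) (U : Set S), a ∈ U → cov a U) ∧
  (∀ (a : S) (U V : Set S), cov a U → covS cov U V → cov a V)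

/-- the way-below relation `a ≪ b`. -/
def wb {S : Type*} (cov : S → Set S → Prop) (a b : S) : Prop :=
  ∀ U : Set S, cov b U → ∃ U₀ : Finset S, ↑U₀ ⊆ U ∧ cov a ↑U₀

/-- the way-below relation between subsets `U ≪ V`. -/
def wbS {S : Type*} (cov : S → Set S → Prop) (U V : Set S) : Prop :=
  ∀ W : Set S, covS cov V W → ∃ W₀ : Finset S, ↑W₀ ⊆ W ∧ covS cov U ↑W₀

/-- A continuous basic cover, with the witnessing function `w`. -/
def IsContinuous {S : Type*} (cov : S → Set S → Prop) (w : S → Set S) : Prop :=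
  (∀ a : S, ∀ b ∈ w a, wb cov b a) ∧ (∀ a : S, cov a (w a))

/-- splitting subsets. -/
def Splitting {S : Type*} (cov : S → Set S → Prop) (V : Set S) : Prop :=
  ∀ (a : S) (U : Set S), a ∈ V → cov a U → (V ∩ U).Nonempty

/-- located subsets. -/
def Located {S : Type*} (cov : S → Set S → Prop) (V : Set S) : Prop :=
  Splitting cov V ∧ ∀ a b : S, wb cov a b → a ∉ V ∨ b ∈ V

/-- inverse image of a relation. -/
def rinv {α β : Type*} (r : α → β → Prop) (U : Set β) : Set α :=
  {x | ∃ a ∈ U, r x a}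

/-- basic cover maps. -/
def IsBCM {α β : Type*} (cov : α → Set α → Prop) (cov' : β → Set β → Prop)
    (r : α → β → Prop) : Prop :=
  ∀ (a : β) (U : Set β), cov' a U → covS cov (rinv r {a}) (rinv r U)

/-- perfect maps. -/
def IsPerfect {α β : Type*} (cov : α → Set α → Prop) (cov' : β → Set β → Prop)
    (r : α → β → Prop) : Prop :=
  ∀ a b : β, wb cov' a b → wbS cov (rinv r {a}) (rinv r {b})

/-- the terminal basic cover `1 = ({∗}, ∈)`. -/
def unitCov : Unit → Set Unit → Prop := fun x U => x ∈ U

/-! ### Formal topologies -/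

/-- `U ↓ V` with respect to a preorder `le`. -/
def down {S : Type*} (le : S → S → Prop) (U V : Set S) : Set S :=
  {c | ∃ a ∈ U, ∃ b ∈ V, le c a ∧ le c b}

/-- A formal topology: a basic cover together with a compatible preorder. -/
def IsFormalTopology {S : Type*} (cov : S → Set S → Prop) (le : S → S → Prop) : Prop :=
  IsBasicCover cov ∧ Reflexive le ∧ Transitive le ∧
  (∀ a b : S, le a b → cov a {b}) ∧
  (∀ (a : S) (U V : Set S), cov a U → cov a V → cov a (down le U V))

/-- formal topology maps. -/
def IsFTM {α β : Type*} (cov : α → Set α → Prop) (le : α → α → Prop)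
    (cov' : β → Set β → Prop) (le' : β → β → Prop) (r : α → β → Prop) : Prop :=
  IsBCM cov cov' r ∧
  covS cov Set.univ (rinv r Set.univ) ∧
  ∀ a b : β, covS cov (down le (rinv r {a}) (rinv r {b})) (rinv r (down le' {a} {b}))

/-- the order on maps. -/
def MapLE {α β : Type*} (cov : α → Set α → Prop) (r s : α → β → Prop) : Prop :=
  ∀ a : β, covS cov (rinv r {a}) (rinv s {a})

/-- equality of maps. -/
def MapEq {α β : Type*} (cov : α → Set α → Prop) (r s : α → β → Prop) : Prop :=
  MapLE cov r s ∧ MapLE cov s r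

/-- composition of relational maps (`comp s r = s ∘ r`). -/
def comp {α β γ : Type*} (s : β → γ → Prop) (r : α → β → Prop) : α → γ → Prop :=
  fun x c => ∃ b, r x b ∧ s b c

/-- `b* = {c | c ↓ b ◁ ∅}`. -/
def star {S : Type*} (cov : S → Set S → Prop) (le : S → S → Prop) (b : S) : Set S :=
  {c | covS cov (down le {c} {b}) ∅}

/-- `b ⋘ a` iff `S ◁ b* ∪ {a}`. -/
def wc {S : Type*} (cov : S → Set S → Prop) (le : S → S → Prop) (b a : S) : Prop :=
  covS cov Set.univ (star cov le b ∪ {a})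

/-- regular formal topologies. -/
def Regular {S : Type*} (cov : S → Set S → Prop) (le : S → S → Prop) : Prop :=
  ∀ a : S, cov a {b | wc cov le b a}

/-- compactness: `S ≪ S`. -/
def Compact {S : Type*} (cov : S → Set S → Prop) : Prop :=
  wbS cov Set.univ Set.univ

/-- stability: `a ≪ a'` and `b ≪ b'` imply `a↓b ≪ a'↓b'`. -/
def Stable {S : Type*} (cov : S → Set S → Prop) (le : S → S → Prop) : Prop :=
  ∀ a a' b b' : S, wb cov a a' → wb cov b b' →
    wbS cov (down le {a} {b}) (down le {a'} {b'})

/-- isomorphism of formal topologies. -/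
def IsIso {α β : Type*} (cov : α → Set α → Prop) (le : α → α → Prop)
    (cov' : β → Set β → Prop) (le' : β → β → Prop) : Prop :=
  ∃ (r : α → β → Prop) (s : β → α → Prop),
    IsFTM cov le cov' le' r ∧ IsFTM cov' le' cov le s ∧
    MapEq cov (comp s r) (fun a b => a = b) ∧
    MapEq cov' (comp r s) (fun a b => a = b)

/-! ### Geometric theories and the covers they present -/

/-- the preorder `A ≤ B ↔ B ⊆ A` on finite sets of generators. -/
def supord {P : Type*} : Finset P → Finset P → Prop := fun A B => B ⊆ A

/-- The cover on `Finset P` inductively generated by a geometric theory `T`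
(an axiom `T A 𝒞` means `⋀A ⊢ ⋁_{B ∈ 𝒞} ⋀B`). -/
inductive GCov {P : Type*} (T : Finset P → Set (Finset P) → Prop) :
    Finset P → Set (Finset P) → Prop where
  | refl {A : Finset P} {𝒰 : Set (Finset P)} : A ∈ 𝒰 → GCov T A 𝒰
  | le {A B : Finset P} {𝒰 : Set (Finset P)} : B ⊆ A → GCov T B 𝒰 → GCov T A 𝒰
  | ax {A : Finset P} {𝒞 𝒰 : Set (Finset P)} (C : Finset P) :
      T A 𝒞 → (∀ B ∈ 𝒞, GCov T (C ∪ B) 𝒰) → GCov T (C ∪ A) 𝒰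

theorem GCov_trans {P : Type*} {T : Finset P → Set (Finset P) → Prop}
    {A : Finset P} {𝒰 𝒱 : Set (Finset P)}
    (h : GCov T A 𝒰) (h' : ∀ B ∈ 𝒰, GCov T B 𝒱) : GCov T A 𝒱 := by
  induction h with
  | refl hA => exact h' _ hA
  | le hBA _ ih => exact GCov.le hBA (ih h')
  | ax C hT _ ih => exact GCov.ax C hT (fun B hB => ih B hB h')

theorem GCov_isBasicCover {P : Type*} (T : Finset P → Set (Finset P) → Prop) :
    IsBasicCover (GCov T) :=
  ⟨fun _ _ h => GCov.refl h, fun _ _ _ h h' => GCov_trans h h'⟩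

/-! ### The patch, Lawson and lower powerlocale theories -/

/-- generators of the patch/Lawson theories : `r a` and `l A`. -/
inductive PatchGen (S : Type u) : Type u where
  | r : S → PatchGen S
  | l : Finset S → PatchGen S

/-- The geometric theory `T_P` presenting the patch of a stably locally compact
formal topology. -/
inductive PatchThy {S : Type*} (cov : S → Set S → Prop) (le : S → S → Prop) :
    Finset (PatchGen S) → Set (Finset (PatchGen S)) → Prop where
  | R1 : PatchThy cov le ∅ {B | ∃ a : S, B = {PatchGen.r a}}
  | R2 (a b : S) :
      PatchThy cov le {PatchGen.r a, PatchGen.r b}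
        {B | ∃ c ∈ down le {a} {b}, B = {PatchGen.r c}}
  | R3 (a : S) (A : Finset S) :
      cov a ↑A → PatchThy cov le {PatchGen.r a} {B | ∃ b ∈ A, B = {PatchGen.r b}}
  | R4 (a : S) :
      PatchThy cov le {PatchGen.r a} {B | ∃ b : S, wb cov b a ∧ B = {PatchGen.r b}}
  | L1 : PatchThy cov le ∅ {({PatchGen.l ∅} : Finset (PatchGen S))}
  | L2 (A B : Finset S) :
      covS cov ↑A ↑B →
      PatchThy cov le {PatchGen.l B} {({PatchGen.l A} : Finset (PatchGen S))}
  | L3 (A B : Finset S) :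
      PatchThy cov le {PatchGen.l A, PatchGen.l B}
        {D | ∃ C : Finset S, wbS cov ↑A ↑C ∧ wbS cov ↑B ↑C ∧ D = {PatchGen.l C}}
  | Loc (a b : S) :
      wb cov a b →
      PatchThy cov le ∅
        {({PatchGen.l {a}} : Finset (PatchGen S)), ({PatchGen.r b} : Finset (PatchGen S))}
  | D (a : S) :
      PatchThy cov le {PatchGen.l {a}, PatchGen.r a} (∅ : Set (Finset (PatchGen S)))

/-- the cover of `Patch(S)`. -/
def patchCov {S : Type*} (cov : S → Set S → Prop) (le : S → S → Prop) :
    Finset (PatchGen S) → Set (Finset (PatchGen S)) → Prop :=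
  GCov (PatchThy cov le)

/-- the counit `ε_P : Patch(S) → S`. -/
def epsP {S : Type*} (cov : S → Set S → Prop) (le : S → S → Prop) :
    Finset (PatchGen S) → S → Prop :=
  fun 𝔄 a => patchCov cov le 𝔄 {({PatchGen.r a} : Finset (PatchGen S))}

/-- The geometric theory `T_L` presenting the Lawson topology of a continuous
basic cover (the axioms of `T_P` without (R1), (R2)). -/
inductive LawsonThy {S : Type*} (cov : S → Set S → Prop) :
    Finset (PatchGen S) → Set (Finset (PatchGen S)) → Prop where
  | R3 (a : S) (A : Finset S) :
      cov a ↑A → LawsonThy cov {PatchGen.r a} {B | ∃ b ∈ A, B = {PatchGen.r b}}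
  | R4 (a : S) :
      LawsonThy cov {PatchGen.r a} {B | ∃ b : S, wb cov b a ∧ B = {PatchGen.r b}}
  | L1 : LawsonThy cov ∅ {({PatchGen.l ∅} : Finset (PatchGen S))}
  | L2 (A B : Finset S) :
      covS cov ↑A ↑B →
      LawsonThy cov {PatchGen.l B} {({PatchGen.l A} : Finset (PatchGen S))}
  | L3 (A B : Finset S) :
      LawsonThy cov {PatchGen.l A, PatchGen.l B}
        {D | ∃ C : Finset S, wbS cov ↑A ↑C ∧ wbS cov ↑B ↑C ∧ D = {PatchGen.l C}}
  | Loc (a b : S) :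
      wb cov a b →
      LawsonThy cov ∅
        {({PatchGen.l {a}} : Finset (PatchGen S)), ({PatchGen.r b} : Finset (PatchGen S))}
  | D (a : S) :
      LawsonThy cov {PatchGen.l {a}, PatchGen.r a} (∅ : Set (Finset (PatchGen S)))

/-- the cover of the Lawson topology `L(S)`. -/
def lawsonCov {S : Type*} (cov : S → Set S → Prop) :
    Finset (PatchGen S) → Set (Finset (PatchGen S)) → Prop :=
  GCov (LawsonThy cov)

/-- the counit `ε_L : L(S) → S`. -/
def epsL {S : Type*} (cov : S → Set S → Prop) : Finset (PatchGen S) → S → Prop :=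
  fun 𝔄 a => lawsonCov cov 𝔄 {({PatchGen.r a} : Finset (PatchGen S))}

/-- The theory presenting the lower powerlocale of a continuous basic cover:
generators `a ∈ S`, axioms (R3) and (R4). -/
inductive LowerThy {S : Type*} (cov : S → Set S → Prop) :
    Finset S → Set (Finset S) → Prop where
  | R3 (a : S) (A : Finset S) :
      cov a ↑A → LowerThy cov {a} {B | ∃ b ∈ A, B = ({b} : Finset S)}
  | R4 (a : S) :
      LowerThy cov {a} {B | ∃ b : S, wb cov b a ∧ B = ({b} : Finset S)}

/-- the cover of the lower powerlocale `Lower(S)`. -/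
def lowerCov {S : Type*} (cov : S → Set S → Prop) :
    Finset S → Set (Finset S) → Prop :=
  GCov (LowerThy cov)

/-- the counit `σ_L : Lower(S) → S`. -/
def sigmaL {S : Type*} (cov : S → Set S → Prop) : Finset S → S → Prop :=
  fun A a => lowerCov cov A ({({a} : Finset S)} : Set (Finset S))

/-! ### de Groot duals -/

/-- `↟A = {B ∈ Fin S | A ≪ B}`. -/
def upF {S : Type*} (cov : S → Set S → Prop) (A : Finset S) : Set (Finset S) :=
  {B | wbS cov ↑A ↑B}

/-- the finite join `⋁^F {↟A | A ∈ 𝒜}` of Scott open filters. -/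
def finJoin {S : Type*} (cov : S → Set S → Prop) (le : S → S → Prop)
    (𝒜 : Finset (Finset S)) : Set (Finset S) :=
  if 𝒜 = ∅ then {B | covS cov Set.univ ↑B}
  else {B | ∃ g : Finset S → Finset S,
    (∀ A ∈ 𝒜, wbS cov ↑A ↑(g A)) ∧
    wbS cov {c | ∀ A ∈ 𝒜, ∃ b ∈ g A, le c b} ↑B}

/-- The cover `◁^D` of the de Groot dual `S^D`, inductively generated on
`(Fin S, ⊇)` by the axioms (D3) `A ◁ ↟A` and (D4). -/
inductive DCov {S : Type*} (cov : S → Set S → Prop) (le : S → S → Prop) :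
    Finset S → Set (Finset S) → Prop where
  | refl {A : Finset S} {𝒰 : Set (Finset S)} : A ∈ 𝒰 → DCov cov le A 𝒰
  | le {A B : Finset S} {𝒰 : Set (Finset S)} :
      B ⊆ A → DCov cov le B 𝒰 → DCov cov le A 𝒰
  | d3 {A A' : Finset S} {𝒰 : Set (Finset S)} :
      A ⊆ A' →
      (∀ C : Finset S, A' ⊆ C → (∃ B : Finset S, wbS cov ↑A ↑B ∧ B ⊆ C) →
        DCov cov le C 𝒰) →
      DCov cov le A' 𝒰
  | d4 {A A' : Finset S} {𝒜 : Finset (Finset S)} {𝒰 : Set (Finset S)} :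
      A ⊆ A' → upF cov A ⊆ finJoin cov le 𝒜 →
      (∀ C : Finset S, A' ⊆ C → (∃ B ∈ 𝒜, B ⊆ C) → DCov cov le C 𝒰) →
      DCov cov le A' 𝒰

/-- the cover of the Scott topology `Σ(S)` on `(Fin S, ⊇)`. -/
def scottCov {S : Type*} (cov : S → Set S → Prop) :
    Finset S → Set (Finset S) → Prop :=
  fun A 𝒰 => upF cov A ⊆ ⋃ B ∈ 𝒰, upF cov B

/-- a filter (with respect to `◁`) of basic opens, given by a set of finite subsets. -/
def IsCovFilter {S : Type*} (cov : S → Set S → Prop) (le : S → S → Prop)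
    (𝒱 : Set (Finset S)) : Prop :=
  𝒱.Nonempty ∧
  (∀ A ∈ 𝒱, ∀ B : Finset S, covS cov ↑A ↑B → B ∈ 𝒱) ∧
  (∀ A ∈ 𝒱, ∀ B ∈ 𝒱, ∃ C ∈ 𝒱, covS cov ↑C (down le ↑A ↑B))

/-- The geometric theory `T^d` presenting the de Groot dual `S^d`:
generators `l A` (identified with `A : Finset S`), axioms (L1)–(L3) and (D4). -/
inductive DGThy {S : Type*} (cov : S → Set S → Prop) (le : S → S → Prop) :
    Finset (Finset S) → Set (Finset (Finset S)) → Prop where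
  | L1 : DGThy cov le ∅ {({(∅ : Finset S)} : Finset (Finset S))}
  | L2 (A B : Finset S) :
      covS cov ↑A ↑B → DGThy cov le {B} {({A} : Finset (Finset S))}
  | L3 (A B : Finset S) :
      DGThy cov le {A, B}
        {D | ∃ C : Finset S, wbS cov ↑A ↑C ∧ wbS cov ↑B ↑C ∧ D = ({C} : Finset (Finset S))}
  | D4 (A : Finset S) (𝒜 : Finset (Finset S)) :
      upF cov A ⊆ finJoin cov le 𝒜 →
      DGThy cov le {A} {D | ∃ B ∈ 𝒜, D = ({B} : Finset (Finset S))}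

/-! ### Spectral formal topologies -/

/-- spectral formal topologies: a compatible meet-semilattice structure on the
base, with every basic element way-below itself. -/
def IsSpectral {S : Type*} (cov : S → Set S → Prop) (le : S → S → Prop)
    (one : S) (meet : S → S → S) : Prop :=
  (∀ a : S, cov a {one}) ∧
  (∀ a b : S, cov (meet a b) (down le {a} {b})) ∧
  (∀ a b : S, ∀ c ∈ down le {a} {b}, cov c {meet a b}) ∧
  (∀ a : S, wb cov a a)

/-! ### Subtopologies -/

/-- the property of being a formal-topology cover compatible with `le`. -/
def IsFTCover {S : Type*} (cov : S → Set S → Prop) (le : S → S → Prop) : Prop :=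
  IsBasicCover cov ∧ (∀ a b : S, le a b → cov a {b}) ∧
  (∀ (a : S) (U V : Set S), cov a U → cov a V → cov a (down le U V))

/-- The meet (in `SubTop(S)`) of a family of subtopology covers: the least
formal-topology cover containing all of them. -/
def covMeet {S : Type*} {ι : Sort*} (le : S → S → Prop)
    (F : ι → (S → Set S → Prop)) : S → Set S → Prop :=
  fun a U => ∀ c : S → Set S → Prop,
    IsFTCover c le → (∀ i : ι, ∀ (a' : S) (U' : Set S), F i a' U' → c a' U') → c a U

/-- the closed subtopology `C_a` determined by `{a}`. -/
def closedCov {S : Type*} (cov : S → Set S → Prop) (a : S) : S → Set S → Prop :=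
  fun c V => cov c ({a} ∪ V)

/-- the open subtopology `S_B` determined by a finite `B`. -/
def openCov {S : Type*} (cov : S → Set S → Prop) (le : S → S → Prop)
    (B : Finset S) : S → Set S → Prop :=
  fun c V => covS cov (down le {c} ↑B) V

/-- `K_A = ⋀_{A ≪ B} S_B`. -/
def KCov {S : Type*} (cov : S → Set S → Prop) (le : S → S → Prop) (A : Finset S) :
    S → Set S → Prop :=
  covMeet le (fun B : {B : Finset S // wbS cov ↑A ↑B} => openCov cov le B.1)

/-- `C_a ∨ K_A` (the join of subtopologies is the intersection of covers). -/
def CKCov {S : Type*} (cov : S → Set S → Prop) (le : S → S → Prop)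
    (a : S) (A : Finset S) : S → Set S → Prop :=
  fun c V => closedCov cov a c V ∧ KCov cov le A c V

/-- perfect subtopologies. -/
def IsPerfectSub {S : Type*} (cov : S → Set S → Prop) (le : S → S → Prop)
    (cov' : S → Set S → Prop) : Prop :=
  IsFTCover cov' le ∧ (∀ (a : S) (U : Set S), cov a U → cov' a U) ∧
  (∀ a b : S, wb cov a b → wb cov' a b)

/-- the order of `PSub(S)`: `(a,A) ≤ (b,B)` iff `C_b ∨ K_B ⊑ C_a ∨ K_A`. -/
def PSubLe {S : Type*} (cov : S → Set S → Prop) (le : S → S → Prop) :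
    S × Finset S → S × Finset S → Prop :=
  fun p q => ∀ (c : S) (V : Set S), CKCov cov le p.1 p.2 c V → CKCov cov le q.1 q.2 c V

/-- the cover of `PSub(S)`: `(a,A) ◁ U` iff `⋀{C_b ∨ K_B | (b,B) ∈ U} ⊑ C_a ∨ K_A`. -/
def covPSub {S : Type*} (cov : S → Set S → Prop) (le : S → S → Prop) :
    S × Finset S → Set (S × Finset S) → Prop :=
  fun p U => ∀ (c : S) (V : Set S), CKCov cov le p.1 p.2 c V →
    covMeet le (fun q : U => CKCov cov le q.1.1 q.1.2) c V

/-- the map `r : PSub(S) → Patch(S)` on generators. -/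
def rGenPS {S : Type*} (cov : S → Set S → Prop) (le : S → S → Prop)
    (p : S × Finset S) : PatchGen S → Prop
  | PatchGen.r b => covPSub cov le p {((b, (∅ : Finset S)) : S × Finset S)}
  | PatchGen.l B => covPSub cov le p {q : S × Finset S | q.2 = B}

/-- the map `r : PSub(S) → Patch(S)`, extended along the presentation. -/
def rPS {S : Type*} (cov : S → Set S → Prop) (le : S → S → Prop) :
    S × Finset S → Finset (PatchGen S) → Prop :=
  fun p 𝔅 => ∀ g ∈ 𝔅, covPSub cov le p (rinv (fun q g' => rGenPS cov le q g') {g})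

/-- the map `s : Patch(S) → PSub(S)`. -/
def sPS {S : Type*} (cov : S → Set S → Prop) (le : S → S → Prop) :
    Finset (PatchGen S) → (S × Finset S) → Prop :=
  fun 𝔄 p => patchCov cov le 𝔄
    ({({PatchGen.r p.1, PatchGen.l p.2} : Finset (PatchGen S))} : Set (Finset (PatchGen S)))

/-! ### Saturated subsets, dcpos and preframes -/

/-- the saturated subsets of a basic cover. -/
abbrev SatSet {α : Type*} (cov : α → Set α → Prop) : Type _ :=
  {U : Set α // ∀ a, cov a U → a ∈ U}

/-- the join of a family of saturated subsets. -/
def satSup {α : Type*} {cov : α → Set α → Prop} (hbc : IsBasicCover cov)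
    (D : Set (SatSet cov)) : SatSet cov :=
  ⟨{a | cov a (⋃ U ∈ D, (U : Set α))}, fun a h => hbc.2 a _ _ h (fun _ hb => hb)⟩

/-- inductively generated basic covers: `BGen Ax` is the cover generated by the
axiom-set with axioms `a ◁ C` for `C ∈ Ax a`. -/
inductive BGen {S : Type*} (Ax : S → Set (Set S)) : S → Set S → Prop where
  | refl {a : S} {U : Set S} : a ∈ U → BGen Ax a U
  | infty {a : S} {U : Set S} (C : Set S) :
      C ∈ Ax a → (∀ b ∈ C, BGen Ax b U) → BGen Ax a U

theorem BGen_trans {S : Type*} {Ax : S → Set (Set S)} {a : S} {U V : Set S}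
    (h : BGen Ax a U) (h' : ∀ b ∈ U, BGen Ax b V) : BGen Ax a V := by
  induction h with
  | refl ha => exact h' _ ha
  | infty C hC _ ih => exact BGen.infty C hC (fun b hb => ih b hb h')

theorem BGen_isBasicCover {S : Type*} (Ax : S → Set (Set S)) :
    IsBasicCover (BGen Ax) :=
  ⟨fun _ _ h => BGen.refl h, fun _ _ _ h h' => BGen_trans h h'⟩

/-- the lower powerlocale theory of an inductively generated basic cover. -/
inductive LowerThyAx {S : Type*} (Ax : S → Set (Set S)) :
    Finset S → Set (Finset S) → Prop where
  | mk (a : S) (C : Set S) :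
      C ∈ Ax a → LowerThyAx Ax {a} {B | ∃ b ∈ C, B = ({b} : Finset S)}

/-- the counit `σ_L : Lower(S) → S` for an inductively generated basic cover. -/
def sigmaLAx {S : Type*} (Ax : S → Set (Set S)) : Finset S → S → Prop :=
  fun A a => GCov (LowerThyAx Ax) A ({({a} : Finset S)} : Set (Finset S))

/-- the top saturated subset of a presented topology. -/
def satTop {P : Type*} (T : Finset P → Set (Finset P) → Prop) : SatSet (GCov T) :=
  ⟨Set.univ, fun _ _ => Set.mem_univ _⟩

/-- binary meets of saturated subsets of a presented topology. -/
def satInfL {P : Type*} (T : Finset P → Set (Finset P) → Prop)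
    (U V : SatSet (GCov T)) : SatSet (GCov T) :=
  ⟨{A | GCov T A (down supord (U : Set (Finset P)) (V : Set (Finset P)))},
   fun _ h => GCov_trans h (fun _ hB => hB)⟩

/-- the suplattice homomorphism `σ_L* : Sat(S) → Sat(Lower(S))`. -/
def sigmaStar {S : Type*} (Ax : S → Set (Set S)) (U : SatSet (BGen Ax)) :
    SatSet (GCov (LowerThyAx Ax)) :=
  ⟨{A : Finset S | GCov (LowerThyAx Ax) A (rinv (sigmaLAx Ax) (U : Set S))},
   fun _ h => GCov_trans h (fun _ hB => hB)⟩

/-- a preframe structure on a partial order: finite meets and directed joins,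
with finite meets distributing over directed joins. -/
structure PreframeStr (X : Type*) [PartialOrder X] where
  top : X
  inf : X → X → X
  dSup : Set X → X
  le_top : ∀ x, x ≤ top
  inf_le_left : ∀ x y, inf x y ≤ x
  inf_le_right : ∀ x y, inf x y ≤ y
  le_inf : ∀ x y z, x ≤ y → x ≤ z → x ≤ inf y z
  le_dSup : ∀ d : Set X, d.Nonempty → DirectedOn (· ≤ ·) d → ∀ x ∈ d, x ≤ dSup d
  dSup_le : ∀ d : Set X, d.Nonempty → DirectedOn (· ≤ ·) d →
    ∀ z, (∀ x ∈ d, x ≤ z) → dSup d ≤ z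
  distrib : ∀ (x : X) (d : Set X), d.Nonempty → DirectedOn (· ≤ ·) d →
    inf x (dSup d) = dSup ((fun y => inf x y) '' d)

/-- dcpo homomorphisms out of `Sat(S)`. -/
def IsDcpoHom {α : Type*} {cov : α → Set α → Prop} (hbc : IsBasicCover cov)
    {X : Type*} [PartialOrder X] (PF : PreframeStr X) (f : SatSet cov → X) : Prop :=
  Monotone f ∧
  ∀ D : Set (SatSet cov), D.Nonempty → DirectedOn (· ≤ ·) D →
    f (satSup hbc D) = PF.dSup (f '' D)

/-- preframe homomorphisms out of the frame of a presented topology. -/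
def IsPreframeHomL {P : Type*} (T : Finset P → Set (Finset P) → Prop)
    {X : Type*} [PartialOrder X] (PF : PreframeStr X)
    (F : SatSet (GCov T) → X) : Prop :=
  Monotone F ∧ F (satTop T) = PF.top ∧
  (∀ U V, F (satInfL T U V) = PF.inf (F U) (F V)) ∧
  ∀ D : Set (SatSet (GCov T)), D.Nonempty → DirectedOn (· ≤ ·) D →
    F (satSup (GCov_isBasicCover T) D) = PF.dSup (F '' D)

/-! ### Located subsets: auxiliary notions -/

/-- the lower part `L_V` associated to a located subset `V`. -/
def LV {S : Type*} (cov : S → Set S → Prop) (V : Set S) : Set S :=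
  {a | ∃ A : Finset S, wbS cov {a} ↑A ∧ (↑A ∩ V : Set S) = ∅}

/-- cuts of a continuous basic cover. -/
def IsCut {S : Type*} (cov : S → Set S → Prop) (L U : Set S) : Prop :=
  (∀ (a : S) (A : Finset S), cov a ↑A → a ∈ U → ((↑A : Set S) ∩ U).Nonempty) ∧
  (∀ a ∈ U, ∃ b : S, wb cov b a ∧ b ∈ U) ∧
  (∀ (a : S) (A : Finset S), cov a ↑A → (↑A : Set S) ⊆ L → a ∈ L) ∧
  (∀ a ∈ L, ∃ A : Finset S, wbS cov {a} ↑A ∧ (↑A : Set S) ⊆ L) ∧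
  (∀ a b : S, wb cov a b → a ∈ L ∨ b ∈ U) ∧
  L ∩ U = ∅

end FTP

namespace FTP

/-! ### Models of geometric theories -/

/-- A model of a geometric theory, given as the set of generators that hold. -/
def Model {P : Type*} (T : Finset P → Set (Finset P) → Prop) (m : Set P) : Prop :=
  ∀ A 𝒞, T A 𝒞 → (↑A : Set P) ⊆ m → ∃ B ∈ 𝒞, (↑B : Set P) ⊆ m

/-- The finitary consequences of a geometric theory. -/
def FinCons {P : Type*} (T : Finset P → Set (Finset P) → Prop) :
    Finset P → Set (Finset P) → Prop :=
  fun A 𝒞 => 𝒞.Finite ∧ GCov T A 𝒞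

section Geometric

variable {P : Type*} {T : Finset P → Set (Finset P) → Prop}

theorem GCov.sound {m : Set P} (hm : Model T m) {A : Finset P} {U : Set (Finset P)}
    (h : GCov T A U) (hA : (↑A : Set P) ⊆ m) : ∃ B ∈ U, (↑B : Set P) ⊆ m := by
  induction h with
  | refl h => exact ⟨_, h, hA⟩
  | le hBA _ ih => exact ih (fun x hx => hA (hBA hx))
  | ax C hT _ ih =>
    rw [Finset.coe_union, Set.union_subset_iff] at hA
    obtain ⟨B, hB, hBm⟩ := hm _ _ hT hA.2
    refine ih B hB ?_
    rw [Finset.coe_union]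
    exact Set.union_subset hA.1 hBm

theorem Model.finCons {m : Set P} (hm : Model T m) : Model (FinCons T) m :=
  fun _ _ h hA => h.2.sound hm hA

theorem GCov.of_rule {A : Finset P} {𝒞 : Set (Finset P)} (h : T A 𝒞) : GCov T A 𝒞 := by
  have := GCov.ax (T := T) (𝒰 := 𝒞) ∅ h
    (fun B hB => by rw [Finset.empty_union]; exact GCov.refl hB)
  rwa [Finset.empty_union] at this

theorem GCov.mono {A : Finset P} {U V : Set (Finset P)} (h : GCov T A U) (hUV : U ⊆ V) :
    GCov T A V :=
  GCov_trans h (fun _ hB => GCov.refl (hUV hB))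

theorem GCov.localize {A : Finset P} {𝒞 U : Set (Finset P)} (h : GCov T A 𝒞) (C : Finset P)
    (hU : ∀ B ∈ 𝒞, GCov T (C ∪ B) U) : GCov T (C ∪ A) U := by
  induction h with
  | refl h => exact hU _ h
  | le hBA _ ih => exact GCov.le (Finset.union_subset_union_right hBA) (ih hU)
  | ax C' hT _ ih =>
    rw [← Finset.union_assoc]
    refine GCov.ax _ hT fun B hB => ?_
    rw [Finset.union_assoc]
    exact ih B hB hU

/-- Completeness for the finitary consequences of a geometric theory. -/
theorem exists_finCons_model {A : Finset P} {U : Set (Finset P)}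
    (h : ∀ U₀ : Finset (Finset P), ↑U₀ ⊆ U → ¬ GCov T A ↑U₀) :
    ∃ m : Set P, ↑A ⊆ m ∧ (∀ B ∈ U, ¬ (↑B : Set P) ⊆ m) ∧ Model (FinCons T) m := by
  let 𝓕 : Set (Set P) := {m | ∀ B : Finset P, ↑B ⊆ m →
    ∀ U₀ : Finset (Finset P), ↑U₀ ⊆ U → ¬ GCov T B ↑U₀}
  have hA : (↑A : Set P) ∈ 𝓕 := fun B hB U₀ hU₀ hcov =>
    h U₀ hU₀ (GCov.le (Finset.coe_subset.1 hB) hcov)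
  obtain ⟨m, hAm, hm⟩ := zorn_subset_nonempty 𝓕 (by
    intro c hc hchain hne
    refine ⟨⋃₀ c, ?_, fun s hs => Set.subset_sUnion_of_mem hs⟩
    intro B hB
    obtain ⟨s, hs, hBs⟩ := DirectedOn.exists_mem_subset_of_finset_subset_biUnion
      (f := id) hne hchain.directedOn
      (s := B) (by simpa [Set.sUnion_eq_biUnion] using hB)
    exact hc hs B hBs) _ hA
  refine ⟨m, hAm, ?_, ?_⟩
  · intro B hB hBm
    exact hm.prop B hBm {B} (by simpa using hB) (GCov.refl (by simp))
  · rintro C 𝒞 ⟨hfin, hcov⟩ hCm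
    by_contra! hno
    have key : ∀ B ∈ 𝒞, ∃ D : Finset P, ∃ U₀ : Finset (Finset P),
        ↑D ⊆ m ∧ ↑U₀ ⊆ U ∧ GCov T (D ∪ B) ↑U₀ := by
      intro B hB
      obtain ⟨g, hgB, hgm⟩ := Set.not_subset.1 (hno B hB)
      have hins : insert g m ∉ 𝓕 := fun hmem =>
        hgm (hm.le_of_ge hmem (Set.subset_insert g m) (Set.mem_insert g m))
      simp only [𝓕, Set.mem_ofPred_eq, not_forall, not_not] at hins
      obtain ⟨D, hD, U₀, hU₀, hcov⟩ := hins
      refine ⟨D.erase g, U₀, ?_, hU₀, GCov.le ?_ hcov⟩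
      · intro x hx
        have hx' := Finset.mem_erase.1 (Finset.mem_coe.1 hx)
        exact (hD hx'.2).resolve_left hx'.1
      · intro x hx
        by_cases hxg : x = g
        · exact Finset.mem_union_right _ (hxg ▸ hgB)
        · exact Finset.mem_union_left _ (Finset.mem_erase.2 ⟨hxg, hx⟩)
    choose! D V hD hV hDV using key
    refine hm.prop (hfin.toFinset.biUnion D ∪ C) ?_ (hfin.toFinset.biUnion V) ?_
      (hcov.localize _ fun B hB => GCov.le
        (Finset.union_subset_union_left (Finset.subset_biUnion_of_mem D (hfin.mem_toFinset.2 hB)))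
        ((hDV B hB).mono ?_))
    · intro x hx
      simp only [Finset.coe_union, Finset.coe_biUnion, Set.mem_union, Set.mem_iUnion] at hx
      rcases hx with ⟨B, hB, hx⟩ | hx
      · exact hD B (hfin.mem_toFinset.1 hB) hx
      · exact hCm hx
    · intro x hx
      simp only [Finset.coe_biUnion, Set.mem_iUnion] at hx
      obtain ⟨B, hB, hx⟩ := hx
      exact hV B (hfin.mem_toFinset.1 hB) hx
    · exact Finset.coe_subset.2 (Finset.subset_biUnion_of_mem V (hfin.mem_toFinset.2 hB))

/-- A relation approximating every generator extends to finite conjunctions. -/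
theorem GCov.approx {R : P → P → Prop}
    (h : ∀ g, GCov T {g} {B | ∃ g', R g' g ∧ B = {g'}}) (A : Finset P) :
    GCov T A {A' | ∀ g ∈ A, ∃ g' ∈ A', R g' g} := by
  induction A using Finset.induction_on with
  | empty => exact GCov.refl (by simp)
  | insert g A _ ih =>
    rw [Finset.insert_eq]
    refine ih.localize _ fun B hB => ?_
    rw [Finset.union_comm]
    refine (h g).localize _ ?_
    rintro _ ⟨g', hg', rfl⟩
    refine GCov.refl ?_
    intro x hx
    rcases Finset.mem_union.1 hx with hx | hx
    · rw [Finset.mem_singleton.1 hx]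
      exact ⟨g', by simp, hg'⟩
    · obtain ⟨y, hy, hyx⟩ := hB x hx
      exact ⟨y, Finset.mem_union_left _ hy, hyx⟩

end Geometric

/-! ### Way-below on subsets -/

section WayBelow

variable {S : Type*} {cov : S → Set S → Prop}

theorem covS.refl (hbc : IsBasicCover cov) {U V : Set S} (h : U ⊆ V) : covS cov U V :=
  fun a ha => hbc.1 a V (h ha)

theorem covS.trans (hbc : IsBasicCover cov) {U V W : Set S} (h : covS cov U V)
    (h' : covS cov V W) : covS cov U W :=
  fun a ha => hbc.2 a V W (h a ha) h'

theorem covS_singleton {a : S} {U : Set S} : covS cov {a} U ↔ cov a U :=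
  ⟨fun h => h a rfl, by rintro h _ rfl; exact h⟩

theorem wbS_singleton {a b : S} : wbS cov {a} {b} ↔ wb cov a b := by
  simp only [wbS, wb, covS_singleton]

theorem wbS.mono (hbc : IsBasicCover cov) {U U' V V' : Set S} (hU : covS cov U U')
    (h : wbS cov U' V) (hV : covS cov V V') : wbS cov U V' := by
  intro W hW
  obtain ⟨W₀, hW₀, hc⟩ := h W (hV.trans hbc hW)
  exact ⟨W₀, hW₀, hU.trans hbc hc⟩

theorem wbS.covS (hbc : IsBasicCover cov) {U V : Set S} (h : wbS cov U V) : covS cov U V := by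
  obtain ⟨W₀, hW₀, hc⟩ := h V (covS.refl hbc subset_rfl)
  exact hc.trans hbc (covS.refl hbc hW₀)

theorem exists_finite_cover (hbc : IsBasicCover cov) {ι : Type*} (E : Finset ι) (F : ι → Set S)
    {W : Set S} (h : ∀ e ∈ E, ∃ W₀ : Finset S, ↑W₀ ⊆ W ∧ FTP.covS cov (F e) ↑W₀) :
    ∃ W₀ : Finset S, ↑W₀ ⊆ W ∧ ∀ e ∈ E, FTP.covS cov (F e) ↑W₀ := by
  choose! V hV hc using h
  refine ⟨E.biUnion V, ?_, fun e he => (hc e he).trans hbc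
    (covS.refl hbc (Finset.coe_subset.2 (Finset.subset_biUnion_of_mem V he)))⟩
  intro x hx
  obtain ⟨e, he, hx⟩ := Finset.mem_biUnion.1 (Finset.mem_coe.1 hx)
  exact hV e he hx

theorem wbS_of_approx (hbc : IsBasicCover cov) {U V : Set S} {E : Finset S}
    (hE : covS cov U ↑E) (h : ∀ e ∈ E, ∃ v ∈ V, wb cov e v) : wbS cov U V := by
  intro W hW
  obtain ⟨W₀, hW₀, hc⟩ := exists_finite_cover hbc E (fun e => {e}) (W := W) (by
    intro e he
    obtain ⟨v, hv, hev⟩ := h e he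
    obtain ⟨W₀, h1, h2⟩ := hev W (hW v hv)
    exact ⟨W₀, h1, covS_singleton.2 h2⟩)
  exact ⟨W₀, hW₀, hE.trans hbc fun e he => hc e he e rfl⟩

variable (hbc : IsBasicCover cov) (hc : ∀ a, cov a {b | wb cov b a})
include hbc hc

theorem covS_approx (V : Set S) : covS cov V {e | ∃ v ∈ V, wb cov e v} :=
  fun a ha => hbc.2 _ _ _ (hc a) (covS.refl hbc fun _ hb => ⟨a, ha, hb⟩)

theorem wbS.exists_approx {U V : Set S} (h : wbS cov U V) :
    ∃ E : Finset S, FTP.covS cov U ↑E ∧ ∀ e ∈ E, ∃ v ∈ V, wb cov e v := by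
  obtain ⟨E, hE, hUE⟩ := h _ (covS_approx hbc hc V)
  exact ⟨E, hUE, hE⟩

theorem wbS.exists_between {U V : Set S} (h : wbS cov U V) :
    ∃ E : Finset S, wbS cov U ↑E ∧ wbS cov ↑E V := by
  obtain ⟨D, hD, hUD⟩ := h _ ((covS_approx hbc hc V).trans hbc (covS_approx hbc hc _))
  have hD' : ∀ d ∈ D, ∃ e, (∃ v ∈ V, wb cov e v) ∧ wb cov d e := fun d hd => hD hd
  choose! f hf hff using hD'
  refine ⟨D.image f, wbS_of_approx hbc hUD fun e he => ⟨f e, Finset.mem_coe.2 (Finset.mem_image_of_mem f he), hff e he⟩,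
    wbS_of_approx hbc (covS.refl hbc subset_rfl) ?_⟩
  intro e he
  obtain ⟨d, hd, rfl⟩ := Finset.mem_image.1 he
  exact hf d hd

end WayBelow

/-! ### Stably compact formal topologies and their points -/

/-- Stably compact formal topologies. -/
structure StablyCompact {S : Type*} (cov : S → Set S → Prop) (le : S → S → Prop) : Prop where
  ft : IsFormalTopology cov le
  cont : ∀ a, cov a {b | wb cov b a}
  comp : Compact cov
  stable : Stable cov le

/-- Formal points. -/
structure IsPt {S : Type*} (cov : S → Set S → Prop) (le : S → S → Prop) (p : Set S) : Prop where
  nonempty : p.Nonempty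
  down : ∀ a ∈ p, ∀ b ∈ p, ∃ c ∈ down le {a} {b}, c ∈ p
  split : ∀ a ∈ p, ∀ U, cov a U → ∃ b ∈ U, b ∈ p

/-- The finite subsets `A` for which `l(A)` holds at the point `p`. -/
def avoid {S : Type*} (cov : S → Set S → Prop) (p : Set S) : Set (Finset S) :=
  {A | ∃ B : Finset S, wbS cov ↑A ↑B ∧ ∀ b ∈ B, b ∉ p}

/-- The generators of the patch that hold at the point `p`. -/
def patchModel {S : Type*} (cov : S → Set S → Prop) (p : Set S) : Set (PatchGen S)
  | PatchGen.r a => a ∈ p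
  | PatchGen.l A => A ∈ avoid cov p

@[simp] theorem r_mem_patchModel {S : Type*} {cov : S → Set S → Prop} {p : Set S} {a : S} :
    PatchGen.r a ∈ patchModel cov p ↔ a ∈ p := Iff.rfl

@[simp] theorem l_mem_patchModel {S : Type*} {cov : S → Set S → Prop} {p : Set S}
    {A : Finset S} : PatchGen.l A ∈ patchModel cov p ↔ A ∈ avoid cov p := Iff.rfl

section Points

variable {S : Type*} {cov : S → Set S → Prop} {le : S → S → Prop}

theorem wbS_down (h : StablyCompact cov le) {A A' B B' : Set S} (hA : wbS cov A A')
    (hB : wbS cov B B') : wbS cov (down le A B) (down le A' B') := by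
  obtain ⟨hbc, hrefl, -, hle, hdown⟩ := h.ft
  obtain ⟨E, hAE, hE⟩ := hA.exists_approx hbc h.cont
  obtain ⟨F, hBF, hF⟩ := hB.exists_approx hbc h.cont
  intro W hW
  obtain ⟨W₀, hW₀, hc⟩ := exists_finite_cover hbc (E ×ˢ F)
    (fun x => down le {x.1} {x.2}) (W := W) (by
    rintro ⟨e, f⟩ hef
    obtain ⟨he, hf⟩ := Finset.mem_product.1 hef
    obtain ⟨e', he', hee⟩ := hE e he
    obtain ⟨f', hf', hff⟩ := hF f hf
    refine h.stable _ _ _ _ hee hff W fun c hc => hW c ?_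
    obtain ⟨x, rfl, y, rfl, hx, hy⟩ := hc
    exact ⟨_, he', _, hf', hx, hy⟩)
  refine ⟨W₀, hW₀, ?_⟩
  rintro c ⟨a, ha, b, hb, hca, hcb⟩
  have h1 : cov c ↑E := hbc.2 _ _ _ (hle _ _ hca) (covS_singleton.2 (hAE a ha))
  have h2 : cov c ↑F := hbc.2 _ _ _ (hle _ _ hcb) (covS_singleton.2 (hBF b hb))
  refine hbc.2 _ _ _ (hdown _ _ _ h1 h2) ?_
  rintro d ⟨e, he, f, hf, hde, hdf⟩
  exact hc (e, f) (Finset.mem_product.2 ⟨he, hf⟩) d ⟨e, rfl, f, rfl, hde, hdf⟩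

theorem IsPt.of_wbS (hbc : IsBasicCover cov) {p : Set S} (hp : IsPt cov le p) {U V : Set S}
    (h : wbS cov U V) {a : S} (ha : a ∈ U) (hap : a ∈ p) : ∃ b ∈ V, b ∈ p :=
  hp.split a hap V (h.covS hbc a ha)

theorem IsPt.of_le (hft : IsFormalTopology cov le) {p : Set S} (hp : IsPt cov le p) {a b : S}
    (hab : le a b) (ha : a ∈ p) : b ∈ p := by
  obtain ⟨c, rfl, hc⟩ := hp.split a ha {b} (hft.2.2.2.1 _ _ hab)
  exact hc

theorem IsPt.exists_lower_bound (hft : IsFormalTopology cov le) {p : Set S}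
    (hp : IsPt cov le p) {ι : Type*} (I : Finset ι) (f : ι → S) (hf : ∀ i ∈ I, f i ∈ p) :
    ∃ c ∈ p, ∀ i ∈ I, le c (f i) := by
  induction I using Finset.induction_on with
  | empty =>
    obtain ⟨c, hc⟩ := hp.nonempty
    exact ⟨c, hc, by simp⟩
  | insert i I _ ih =>
    obtain ⟨c, hc, hcI⟩ := ih fun j hj => hf j (Finset.mem_insert_of_mem hj)
    obtain ⟨d, ⟨_, rfl, _, rfl, h1, h2⟩, hd⟩ := hp.down c hc _ (hf i (Finset.mem_insert_self _ _))
    refine ⟨d, hd, fun j hj => ?_⟩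
    rcases Finset.mem_insert.1 hj with rfl | hj
    · exact h2
    · exact hft.2.2.1 h1 (hcI j hj)

theorem not_mem_avoid (hbc : IsBasicCover cov) {p : Set S} (hp : IsPt cov le p) {A : Finset S}
    {a : S} (ha : a ∈ A) (hap : a ∈ p) : A ∉ avoid cov p := by
  rintro ⟨B, hB, hBp⟩
  obtain ⟨b, hb, hbp⟩ := hp.of_wbS hbc hB ha hap
  exact hBp b hb hbp

theorem avoid_of_covS (hbc : IsBasicCover cov) {p : Set S} {A B : Finset S}
    (h : covS cov ↑A ↑B) (hB : B ∈ avoid cov p) : A ∈ avoid cov p := by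
  obtain ⟨C, hC, hCp⟩ := hB
  exact ⟨C, hC.mono hbc h (covS.refl hbc subset_rfl), hCp⟩

theorem avoid_directed (hbc : IsBasicCover cov) (hc : ∀ a, cov a {b | wb cov b a}) {p : Set S}
    {A B : Finset S} (hA : A ∈ avoid cov p) (hB : B ∈ avoid cov p) :
    ∃ C : Finset S, wbS cov ↑A ↑C ∧ wbS cov ↑B ↑C ∧ C ∈ avoid cov p := by
  obtain ⟨A', hA', hAp⟩ := hA
  obtain ⟨B', hB', hBp⟩ := hB
  obtain ⟨A₁, h1, h2⟩ := hA'.exists_between hbc hc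
  obtain ⟨B₁, h3, h4⟩ := hB'.exists_between hbc hc
  refine ⟨A₁ ∪ B₁, h1.mono hbc (covS.refl hbc subset_rfl) (covS.refl hbc (by simp)),
    h3.mono hbc (covS.refl hbc subset_rfl) (covS.refl hbc (by simp)), A' ∪ B', ?_, ?_⟩
  · obtain ⟨E, hE, hE'⟩ := h2.exists_approx hbc hc
    obtain ⟨F, hF, hF'⟩ := h4.exists_approx hbc hc
    refine wbS_of_approx hbc (E := E ∪ F) ?_ ?_
    · intro x hx
      rcases Finset.mem_union.1 (Finset.mem_coe.1 hx) with hx | hx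
      · exact hbc.2 _ _ _ (hE x hx) (covS.refl hbc (by simp))
      · exact hbc.2 _ _ _ (hF x hx) (covS.refl hbc (by simp))
    · intro e he
      rcases Finset.mem_union.1 he with he | he
      · obtain ⟨v, hv, hev⟩ := hE' e he
        exact ⟨v, by simp_all, hev⟩
      · obtain ⟨v, hv, hev⟩ := hF' e he
        exact ⟨v, by simp_all, hev⟩
  · intro b hb
    rcases Finset.mem_union.1 hb with hb | hb
    · exact hAp b hb
    · exact hBp b hb

theorem empty_mem_avoid (hbc : IsBasicCover cov) (p : Set S) : ∅ ∈ avoid cov p :=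
  ⟨∅, wbS_of_approx hbc (E := ∅) (covS.refl hbc subset_rfl) (by simp), by simp⟩

theorem patchModel_isModel (h : StablyCompact cov le) {p : Set S} (hp : IsPt cov le p) :
    Model (PatchThy cov le) (patchModel cov p) := by
  have hbc := h.ft.1
  intro A 𝒞 hT hA
  cases hT with
  | R1 =>
    obtain ⟨a, ha⟩ := hp.nonempty
    exact ⟨_, ⟨a, rfl⟩, by simpa using ha⟩
  | R2 a b =>
    obtain ⟨c, hc, hcp⟩ := hp.down a (hA (a := PatchGen.r a) (by simp)) b (hA (a := PatchGen.r b) (by simp))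
    exact ⟨_, ⟨c, hc, rfl⟩, by simpa using hcp⟩
  | R3 a A hcov =>
    obtain ⟨c, hc, hcp⟩ := hp.split a (hA (a := PatchGen.r a) (by simp)) _ hcov
    exact ⟨_, ⟨c, hc, rfl⟩, by simpa using hcp⟩
  | R4 a =>
    obtain ⟨c, hc, hcp⟩ := hp.split a (hA (a := PatchGen.r a) (by simp)) _ (h.cont a)
    exact ⟨_, ⟨c, hc, rfl⟩, by simpa using hcp⟩
  | L1 =>
    refine ⟨_, rfl, ?_⟩
    rw [Finset.coe_singleton, Set.singleton_subset_iff]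
    exact empty_mem_avoid hbc p
  | L2 A B hcov =>
    have hB : B ∈ avoid cov p := hA (a := PatchGen.l B) (by simp)
    refine ⟨_, rfl, ?_⟩
    rw [Finset.coe_singleton, Set.singleton_subset_iff]
    exact avoid_of_covS hbc hcov hB
  | L3 A B =>
    have h1 : A ∈ avoid cov p := hA (a := PatchGen.l A) (by simp)
    have h2 : B ∈ avoid cov p := hA (a := PatchGen.l B) (by simp)
    obtain ⟨C, hAC, hBC, hC⟩ := avoid_directed hbc h.cont h1 h2
    refine ⟨_, ⟨C, hAC, hBC, rfl⟩, ?_⟩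
    rw [Finset.coe_singleton, Set.singleton_subset_iff]
    exact hC
  | Loc a b hab =>
    by_cases hb : b ∈ p
    · exact ⟨_, Or.inr rfl, by simpa using hb⟩
    · refine ⟨_, Or.inl rfl, ?_⟩
      rw [Finset.coe_singleton, Set.singleton_subset_iff]
      exact ⟨{b}, by simpa using wbS_singleton.2 hab, by simpa using hb⟩
  | D a =>
    have h1 : {a} ∈ avoid cov p := hA (a := PatchGen.l {a}) (by simp)
    exact absurd h1 (not_mem_avoid hbc hp (a := a) (by simp) (hA (a := PatchGen.r a) (by simp)))

end Points

/-! ### Spatiality of the patch -/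

section PatchSpatial

variable {S : Type*} {cov : S → Set S → Prop} {le : S → S → Prop} {m : Set (PatchGen S)}

theorem finite_generators {ι P : Type*} (E : Finset ι) (f : ι → P) :
    {B : Finset P | ∃ e ∈ E, B = {f e}}.Finite :=
  (E.finite_toSet.image fun e => ({f e} : Finset P)).subset (by
    rintro _ ⟨e, he, rfl⟩
    exact ⟨e, he, rfl⟩)

theorem mem_of_cov_fin (hm : Model (FinCons (PatchThy cov le)) m) {a : S} {E : Finset S}
    (ha : PatchGen.r a ∈ m) (hE : cov a ↑E) : ∃ e ∈ E, PatchGen.r e ∈ m := by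
  obtain ⟨_, ⟨e, he, rfl⟩, h⟩ := hm _ _
    ⟨finite_generators E PatchGen.r, GCov.of_rule (PatchThy.R3 a E hE)⟩ (by simpa using ha)
  exact ⟨e, he, h (by simp)⟩

theorem mem_of_covS_univ (hm : Model (FinCons (PatchThy cov le)) m) {E : Finset S}
    (hE : covS cov Set.univ ↑E) : ∃ e ∈ E, PatchGen.r e ∈ m := by
  obtain ⟨_, ⟨e, he, rfl⟩, h⟩ := hm ∅ _
    ⟨finite_generators E PatchGen.r, GCov_trans (GCov.of_rule PatchThy.R1) (by
      rintro _ ⟨a, rfl⟩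
      exact GCov.of_rule (PatchThy.R3 a E (hE a trivial)))⟩ (by simp)
  exact ⟨e, he, h (by simp)⟩

theorem mem_of_covS_down (hm : Model (FinCons (PatchThy cov le)) m) {a b : S} {E : Finset S}
    (ha : PatchGen.r a ∈ m) (hb : PatchGen.r b ∈ m) (hE : covS cov (down le {a} {b}) ↑E) :
    ∃ e ∈ E, PatchGen.r e ∈ m := by
  obtain ⟨_, ⟨e, he, rfl⟩, h⟩ := hm {PatchGen.r a, PatchGen.r b} _
    ⟨finite_generators E PatchGen.r, GCov_trans (GCov.of_rule (PatchThy.R2 a b)) (by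
      rintro _ ⟨c, hc, rfl⟩
      exact GCov.of_rule (PatchThy.R3 c E (hE c hc)))⟩ (by
        intro x hx
        simp only [Finset.coe_insert, Finset.coe_singleton, Set.mem_insert_iff,
          Set.mem_singleton_iff] at hx
        rcases hx with rfl | rfl <;> assumption)
  exact ⟨e, he, h (by simp)⟩

theorem l_mem_of_covS (hm : Model (FinCons (PatchThy cov le)) m) {A B : Finset S}
    (hAB : covS cov ↑A ↑B) (hB : PatchGen.l B ∈ m) : PatchGen.l A ∈ m := by
  obtain ⟨_, rfl, h⟩ := hm _ _
    ⟨Set.finite_singleton _, GCov.of_rule (PatchThy.L2 A B hAB)⟩ (by simpa using hB)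
  exact h (by simp)

theorem l_mem_of_forall (hbc : IsBasicCover cov) (hm : Model (FinCons (PatchThy cov le)) m)
    {E : Finset S} (hE : ∀ e ∈ E, PatchGen.l {e} ∈ m) : PatchGen.l E ∈ m := by
  induction E using Finset.induction_on with
  | empty =>
    obtain ⟨_, rfl, h⟩ := hm _ _ ⟨Set.finite_singleton _, GCov.of_rule PatchThy.L1⟩ (by simp)
    exact h (by simp)
  | insert e E _ ih =>
    have h1 := hE e (Finset.mem_insert_self _ _)
    have h2 := ih fun x hx => hE x (Finset.mem_insert_of_mem hx)
    obtain ⟨_, rfl, h⟩ := hm {PatchGen.l {e}, PatchGen.l E} {{PatchGen.l (insert e E)}}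
      ⟨Set.finite_singleton _, GCov_trans (GCov.of_rule (PatchThy.L3 {e} E)) (by
        rintro _ ⟨C, h1, h2, rfl⟩
        refine GCov.of_rule (PatchThy.L2 _ _ ?_)
        intro x hx
        rcases Finset.mem_insert.1 (Finset.mem_coe.1 hx) with rfl | hx
        · exact h1.covS hbc x (by simp)
        · exact h2.covS hbc x hx)⟩ (by
        intro x hx
        simp only [Finset.coe_insert, Finset.coe_singleton, Set.mem_insert_iff,
          Set.mem_singleton_iff] at hx
        rcases hx with rfl | rfl <;> assumption)
    exact h (by simp)

theorem not_l_and_r (hm : Model (FinCons (PatchThy cov le)) m) {a : S}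
    (hl : PatchGen.l {a} ∈ m) (hr : PatchGen.r a ∈ m) : False := by
  obtain ⟨_, h, -⟩ := hm _ _ ⟨Set.finite_empty, GCov.of_rule (PatchThy.D a)⟩ (by
        intro x hx
        simp only [Finset.coe_insert, Finset.coe_singleton, Set.mem_insert_iff,
          Set.mem_singleton_iff] at hx
        rcases hx with rfl | rfl <;> assumption)
  exact h

theorem l_or_r (hm : Model (FinCons (PatchThy cov le)) m) {a b : S} (hab : wb cov a b) :
    PatchGen.l {a} ∈ m ∨ PatchGen.r b ∈ m := by
  obtain ⟨_, rfl | rfl, h⟩ := hm _ _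
    ⟨(Set.finite_singleton _).insert _, GCov.of_rule (PatchThy.Loc a b hab)⟩ (by simp)
  · exact Or.inl (h (by simp))
  · exact Or.inr (h (by simp))

/-- The point associated with a model of the finitary consequences of the patch theory. -/
def roundedPt (cov : S → Set S → Prop) (m : Set (PatchGen S)) : Set S :=
  {a | ∃ b, wb cov b a ∧ PatchGen.r b ∈ m}

theorem roundedPt_isPt (h : StablyCompact cov le) (hm : Model (FinCons (PatchThy cov le)) m) :
    IsPt cov le (roundedPt cov m) := by
  have hbc := h.ft.1
  refine ⟨?_, ?_, ?_⟩
  · obtain ⟨E, hE, hE'⟩ := wbS.exists_approx hbc h.cont h.comp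
    obtain ⟨e, he, hem⟩ := mem_of_covS_univ hm hE
    obtain ⟨v, -, hv⟩ := hE' e he
    exact ⟨v, e, hv, hem⟩
  · rintro a ⟨a', ha, ham⟩ b ⟨b', hb, hbm⟩
    obtain ⟨E, hE, hE'⟩ := (h.stable _ _ _ _ ha hb).exists_approx hbc h.cont
    obtain ⟨e, he, hem⟩ := mem_of_covS_down hm ham hbm hE
    obtain ⟨c, hc, hec⟩ := hE' e he
    exact ⟨c, hc, e, hec, hem⟩
  · rintro a ⟨a', ha, ham⟩ U hU
    obtain ⟨E, hE, hE'⟩ := ((wbS_singleton.2 ha).mono hbc (covS.refl hbc subset_rfl)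
      (covS_singleton.2 hU)).exists_approx hbc h.cont
    obtain ⟨e, he, hem⟩ := mem_of_cov_fin hm ham (covS_singleton.1 hE)
    obtain ⟨c, hc, hec⟩ := hE' e he
    exact ⟨c, hc, e, hec, hem⟩

theorem patchModel_roundedPt_subset (h : StablyCompact cov le)
    (hm : Model (FinCons (PatchThy cov le)) m) : patchModel cov (roundedPt cov m) ⊆ m := by
  have hbc := h.ft.1
  rintro (a | A) hg
  · obtain ⟨b, hba, hb⟩ : a ∈ roundedPt cov m := hg
    have hcov : cov b ↑({a} : Finset S) := by
      simpa using covS_singleton.1 ((wbS_singleton.2 hba).covS hbc)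
    obtain ⟨e, he, hem⟩ := mem_of_cov_fin hm hb hcov
    rwa [Finset.mem_singleton.1 he] at hem
  · obtain ⟨B, hB, hBp⟩ : A ∈ avoid cov (roundedPt cov m) := hg
    obtain ⟨C, hAC, hCB⟩ := hB.exists_between hbc h.cont
    obtain ⟨E, hE, hE'⟩ := hCB.exists_approx hbc h.cont
    obtain ⟨F, hF, hF'⟩ := (hAC.mono hbc (covS.refl hbc subset_rfl) hE).exists_approx hbc h.cont
    refine l_mem_of_covS hm hF (l_mem_of_forall hbc hm fun f hf => ?_)
    obtain ⟨e, he, hfe⟩ := hF' f hf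
    obtain ⟨b, hb, heb⟩ := hE' e he
    exact (l_or_r hm hfe).resolve_right fun hr => hBp b hb ⟨e, heb, hr⟩

/-- Approximation of generators of the patch. -/
def patchApprox (cov : S → Set S → Prop) : PatchGen S → PatchGen S → Prop
  | PatchGen.r b, PatchGen.r a => wb cov b a
  | PatchGen.l B, PatchGen.l A => wbS cov ↑A ↑B
  | _, _ => False

theorem patchCov_approx (g : PatchGen S) :
    GCov (PatchThy cov le) {g} {B | ∃ g', patchApprox cov g' g ∧ B = {g'}} := by
  cases g with
  | r a =>
    refine (GCov.of_rule (PatchThy.R4 a)).mono ?_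
    rintro _ ⟨b, hb, rfl⟩
    exact ⟨PatchGen.r b, hb, rfl⟩
  | l A =>
    have := GCov.of_rule (PatchThy.L3 (cov := cov) (le := le) A A)
    rw [Finset.pair_eq_singleton] at this
    refine this.mono ?_
    rintro _ ⟨B, hB, -, rfl⟩
    exact ⟨PatchGen.l B, hB, rfl⟩

theorem mem_patchModel_of_approx (h : StablyCompact cov le)
    (hm : Model (FinCons (PatchThy cov le)) m) {g g' : PatchGen S} (hg : patchApprox cov g' g)
    (hg' : g' ∈ m) : g ∈ patchModel cov (roundedPt cov m) := by
  have hbc := h.ft.1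
  match g', g, hg with
  | PatchGen.r b, PatchGen.r a, hg => exact ⟨b, hg, hg'⟩
  | PatchGen.l B, PatchGen.l A, hg =>
    obtain ⟨C, hAC, hCB⟩ := wbS.exists_between hbc h.cont hg
    refine ⟨C, hAC, ?_⟩
    rintro c hc ⟨e, hec, he⟩
    refine not_l_and_r hm (l_mem_of_covS hm ?_ hg') he
    rw [Finset.coe_singleton, covS_singleton]
    exact hbc.2 _ _ _ (covS_singleton.1 ((wbS_singleton.2 hec).covS hbc))
      (covS_singleton.2 (hCB.covS hbc c hc))

/-- The patch of a stably compact formal topology has enough points, and they are the points of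
the formal topology. -/
theorem patchCov_iff (h : StablyCompact cov le) {A : Finset (PatchGen S)}
    {U : Set (Finset (PatchGen S))} :
    patchCov cov le A U ↔ ∀ p, IsPt cov le p → (↑A : Set _) ⊆ patchModel cov p →
      ∃ B ∈ U, (↑B : Set _) ⊆ patchModel cov p := by
  refine ⟨fun hA p hp => GCov.sound (patchModel_isModel h hp) hA, fun hA => ?_⟩
  refine GCov_trans (GCov.approx patchCov_approx A) fun A' hA' => ?_
  by_contra hno
  obtain ⟨m, hAm, hU, hm⟩ := exists_finCons_model (T := PatchThy cov le) (A := A') (U := U)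
    fun U₀ hU₀ hc => hno (hc.mono hU₀)
  obtain ⟨B, hB, hBm⟩ := hA _ (roundedPt_isPt h hm) (by
    intro g hg
    obtain ⟨g', hg', hgg⟩ := hA' g hg
    exact mem_patchModel_of_approx h hm hgg (hAm hg'))
  exact hU B hB (hBm.trans (patchModel_roundedPt_subset h hm))

end PatchSpatial

/-! ### Points of the de Groot dual -/

section Dual

variable {S : Type*} {cov : S → Set S → Prop} {le : S → S → Prop} {m : Set (Finset S)}

theorem avoid_isModel (h : StablyCompact cov le) {p : Set S} (hp : IsPt cov le p) :
    Model (DGThy cov le) (avoid cov p) := by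
  have hbc := h.ft.1
  intro A 𝒞 hT hA
  cases hT with
  | L1 => exact ⟨_, rfl, by simpa using empty_mem_avoid hbc p⟩
  | L2 A B hcov => exact ⟨_, rfl, by simpa using avoid_of_covS hbc hcov (hA (by simp))⟩
  | L3 A B =>
    obtain ⟨C, hAC, hBC, hC⟩ :=
      avoid_directed hbc h.cont (hA (a := A) (by simp)) (hA (a := B) (by simp))
    exact ⟨_, ⟨C, hAC, hBC, rfl⟩, by simpa using hC⟩
  | D4 A 𝒜 hup =>
    obtain ⟨B, hAB, hBp⟩ := hA (a := A) (by simp)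
    have hB := hup hAB
    by_contra! hno
    have hno' : ∀ D ∈ 𝒜, D ∉ avoid cov p := fun D hD hDp =>
      hno {D} ⟨D, hD, rfl⟩ (by simpa using hDp)
    unfold finJoin at hB
    split_ifs at hB with h𝒜
    · obtain ⟨a, ha⟩ := hp.nonempty
      obtain ⟨b, hb, hbp⟩ := hp.split a ha _ (hB a trivial)
      exact hBp b hb hbp
    · obtain ⟨g, hg, hgB⟩ := hB
      have hex : ∀ D ∈ 𝒜, ∃ b ∈ g D, b ∈ p := by
        intro D hD
        by_contra! hgD
        exact hno' D hD ⟨g D, hg D hD, hgD⟩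
      have : Nonempty S := hp.nonempty.to_type
      choose! f hf hfp using hex
      obtain ⟨c, hc, hcle⟩ := hp.exists_lower_bound h.ft 𝒜 f hfp
      obtain ⟨b, hb, hbp⟩ := hp.of_wbS hbc hgB (a := c)
        (fun D hD => ⟨f D, hf D hD, hcle D hD⟩) hc
      exact hBp b hb hbp

theorem dual_mem_of_covS (hm : Model (FinCons (DGThy cov le)) m) {A B : Finset S}
    (hAB : covS cov ↑A ↑B) (hB : B ∈ m) : A ∈ m := by
  obtain ⟨_, rfl, h⟩ := hm _ _
    ⟨Set.finite_singleton _, GCov.of_rule (DGThy.L2 A B hAB)⟩ (by simpa using hB)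
  exact h (by simp)

theorem dual_mem_of_forall (hbc : IsBasicCover cov) (hm : Model (FinCons (DGThy cov le)) m)
    {E : Finset S} (hE : ∀ e ∈ E, {e} ∈ m) : E ∈ m := by
  induction E using Finset.induction_on with
  | empty =>
    obtain ⟨_, rfl, h⟩ := hm _ _ ⟨Set.finite_singleton _, GCov.of_rule DGThy.L1⟩ (by simp)
    exact h (by simp)
  | insert e E _ ih =>
    have h1 := hE e (Finset.mem_insert_self _ _)
    have h2 := ih fun x hx => hE x (Finset.mem_insert_of_mem hx)
    obtain ⟨_, rfl, h⟩ := hm _ {{insert e E}}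
      ⟨Set.finite_singleton _, GCov_trans (GCov.of_rule (DGThy.L3 {e} E)) (by
        rintro _ ⟨C, h1, h2, rfl⟩
        refine GCov.of_rule (DGThy.L2 _ _ ?_)
        intro x hx
        rcases Finset.mem_insert.1 (Finset.mem_coe.1 hx) with rfl | hx
        · exact h1.covS hbc x (by simp)
        · exact h2.covS hbc x hx)⟩ (by
        intro x hx
        simp only [Finset.coe_insert, Finset.coe_singleton, Set.mem_insert_iff,
          Set.mem_singleton_iff] at hx
        rcases hx with rfl | rfl <;> assumption)
    exact h (by simp)

theorem dual_prime (hm : Model (FinCons (DGThy cov le)) m) {A : Finset S}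
    {𝒜 : Finset (Finset S)} (hA : A ∈ m) (h𝒜 : upF cov A ⊆ finJoin cov le 𝒜) :
    ∃ B ∈ 𝒜, B ∈ m := by
  obtain ⟨_, ⟨B, hB, rfl⟩, h⟩ := hm _ _
    ⟨finite_generators 𝒜 id, GCov.of_rule (DGThy.D4 A 𝒜 h𝒜)⟩ (by simpa using hA)
  exact ⟨B, hB, h (by simp)⟩

/-- The point associated with a model of the finitary consequences of the dual theory. -/
def dualRoundedPt (cov : S → Set S → Prop) (m : Set (Finset S)) : Set S :=
  {a | ∃ b, wb cov b a ∧ {b} ∉ m}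

theorem dualRoundedPt_isPt (h : StablyCompact cov le) (hm : Model (FinCons (DGThy cov le)) m) :
    IsPt cov le (dualRoundedPt cov m) := by
  have hbc := h.ft.1
  have hsplit : ∀ a ∈ dualRoundedPt cov m, ∀ U, cov a U → ∃ b ∈ U, b ∈ dualRoundedPt cov m := by
    rintro a ⟨b, hba, hbm⟩ U hU
    obtain ⟨E, hE, hE'⟩ := ((wbS_singleton.2 hba).mono hbc (covS.refl hbc subset_rfl)
      (covS_singleton.2 hU)).exists_approx hbc h.cont
    by_contra! hno
    refine hbm (dual_mem_of_covS hm (B := E) (by simpa using hE)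
      (dual_mem_of_forall hbc hm fun e he => ?_))
    obtain ⟨c, hc, hec⟩ := hE' e he
    by_contra hem
    exact hno c hc ⟨e, hec, hem⟩
  refine ⟨?_, ?_, hsplit⟩
  · obtain ⟨E, hE, hE'⟩ := wbS.exists_approx hbc h.cont h.comp
    by_contra hno
    have hEm : E ∈ m := by
      refine dual_mem_of_forall hbc hm fun e he => ?_
      obtain ⟨v, -, hev⟩ := hE' e he
      by_contra hem
      exact hno ⟨v, e, hev, hem⟩
    obtain ⟨B, hB, -⟩ := dual_prime (𝒜 := ∅) hm hEm (by
      intro B hB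
      have hEB : wbS cov ↑E ↑B := hB
      simpa [finJoin] using hE.trans hbc (hEB.covS hbc))
    exact absurd hB (Finset.notMem_empty B)
  · rintro a₁ ⟨b₁, hb₁, hbm₁⟩ a₂ ⟨b₂, hb₂, hbm₂⟩
    obtain ⟨F₁, hF₁, hF₁'⟩ := (wbS_singleton.2 hb₁).exists_between hbc h.cont
    obtain ⟨F₂, hF₂, hF₂'⟩ := (wbS_singleton.2 hb₂).exists_between hbc h.cont
    obtain ⟨E, hE, hE'⟩ := (wbS_down h hF₁' hF₂').exists_approx hbc h.cont
    by_contra! hno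
    have hEm : E ∈ m := by
      refine dual_mem_of_forall hbc hm fun e he => ?_
      obtain ⟨v, hv, hev⟩ := hE' e he
      by_contra hem
      exact hno v hv ⟨e, hev, hem⟩
    by_cases hbb : b₁ = b₂
    · subst hbb
      refine hbm₁ (dual_mem_of_covS hm (B := E) ?_ hEm)
      rw [Finset.coe_singleton, covS_singleton]
      exact hbc.2 _ _ _ (h.ft.2.2.2.2 _ _ _ (covS_singleton.1 (hF₁.covS hbc))
        (covS_singleton.1 (hF₂.covS hbc))) hE
    · have hne : ({b₂} : Finset S) ≠ {b₁} := fun heq => hbb (Finset.singleton_injective heq).symm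
      obtain ⟨B, hB, hBm⟩ := dual_prime (𝒜 := {{b₁}, {b₂}}) hm hEm (by
        intro B hB
        have hEB : wbS cov ↑E ↑B := hB
        rw [finJoin, if_neg (Finset.insert_ne_empty _ _)]
        refine ⟨fun X => if X = {b₁} then F₁ else F₂, ?_, ?_⟩
        · intro X hX
          rcases Finset.mem_insert.1 hX with rfl | hX
          · simpa using hF₁
          · rw [Finset.mem_singleton.1 hX]
            simpa [hne] using hF₂
        · refine hEB.mono hbc (covS.trans hbc (covS.refl hbc ?_) hE) (covS.refl hbc subset_rfl)
          intro c hc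
          obtain ⟨x, hx, hcx⟩ := hc {b₁} (by simp)
          obtain ⟨y, hy, hcy⟩ := hc {b₂} (by simp)
          simp only at hx
          simp only [if_neg hne] at hy
          exact ⟨x, hx, y, hy, hcx, hcy⟩)
      rcases Finset.mem_insert.1 hB with rfl | hB
      · exact hbm₁ hBm
      · exact hbm₂ (Finset.mem_singleton.1 hB ▸ hBm)

theorem avoid_dualRoundedPt_subset (h : StablyCompact cov le)
    (hm : Model (FinCons (DGThy cov le)) m) : avoid cov (dualRoundedPt cov m) ⊆ m := by
  have hbc := h.ft.1
  rintro A ⟨B, hB, hBp⟩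
  obtain ⟨E, hE, hE'⟩ := hB.exists_approx hbc h.cont
  refine dual_mem_of_covS hm hE (dual_mem_of_forall hbc hm fun e he => ?_)
  obtain ⟨b, hb, heb⟩ := hE' e he
  by_contra hem
  exact hBp b hb ⟨e, heb, hem⟩

theorem mem_avoid_dualRoundedPt (h : StablyCompact cov le)
    (hm : Model (FinCons (DGThy cov le)) m) {A B : Finset S} (hAB : wbS cov ↑A ↑B)
    (hB : B ∈ m) : A ∈ avoid cov (dualRoundedPt cov m) := by
  have hbc := h.ft.1
  obtain ⟨C, hAC, hCB⟩ := hAB.exists_between hbc h.cont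
  refine ⟨C, hAC, ?_⟩
  rintro c hc ⟨e, hec, he⟩
  refine he (dual_mem_of_covS hm ?_ hB)
  rw [Finset.coe_singleton, covS_singleton]
  exact hbc.2 _ _ _ (covS_singleton.1 ((wbS_singleton.2 hec).covS hbc))
    (covS_singleton.2 (hCB.covS hbc c hc))

theorem dualCov_exists_finite (h : StablyCompact cov le) {A A' : Finset (Finset S)}
    {U : Set (Finset (Finset S))} (hA' : ∀ B ∈ A, ∃ B' ∈ A', wbS cov ↑B ↑B')
    (hA : GCov (DGThy cov le) A U) :
    ∃ U₀ : Finset (Finset (Finset S)), ↑U₀ ⊆ U ∧ GCov (DGThy cov le) A' ↑U₀ := by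
  by_contra! hno
  obtain ⟨m, hAm, hU, hm⟩ := exists_finCons_model hno
  obtain ⟨B, hB, hBm⟩ := hA.sound (avoid_isModel h (dualRoundedPt_isPt h hm)) (by
    intro C hC
    obtain ⟨C', hC', hCC⟩ := hA' C hC
    exact mem_avoid_dualRoundedPt h hm hCC (hAm hC'))
  exact hU B hB (hBm.trans (avoid_dualRoundedPt_subset h hm))

theorem dualCov_approx (A : Finset (Finset S)) :
    GCov (DGThy cov le) A {A' | ∀ B ∈ A, ∃ B' ∈ A', wbS cov ↑B ↑B'} := by
  refine GCov.approx (R := fun B' B : Finset S => wbS cov ↑B ↑B') (fun B => ?_) A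
  have := GCov.of_rule (DGThy.L3 (cov := cov) (le := le) B B)
  rw [Finset.pair_eq_singleton] at this
  refine this.mono ?_
  rintro _ ⟨C, hC, -, rfl⟩
  exact ⟨C, hC, rfl⟩

theorem dual_wb (h : StablyCompact cov le) {A A' : Finset (Finset S)}
    (hA' : ∀ B ∈ A, ∃ B' ∈ A', wbS cov ↑B ↑B') : wb (GCov (DGThy cov le)) A' A :=
  fun _ hU => dualCov_exists_finite h hA' hU

theorem GCov.down {P : Type*} {T : Finset P → Set (Finset P) → Prop} {A : Finset P}
    {U V : Set (Finset P)} (hU : GCov T A U) (hV : GCov T A V) :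
    GCov T A (down supord U V) := by
  have : GCov T (A ∪ A) (FTP.down supord U V) := by
    refine hU.localize A fun B hB => ?_
    rw [Finset.union_comm]
    refine hV.localize B fun C hC => ?_
    exact GCov.refl ⟨B, hB, C, hC, Finset.subset_union_left, Finset.subset_union_right⟩
  rwa [Finset.union_self] at this

theorem GCov_isFormalTopology {P : Type*} (T : Finset P → Set (Finset P) → Prop) :
    IsFormalTopology (GCov T) supord :=
  ⟨GCov_isBasicCover T, fun _ => Finset.Subset.refl _, fun _ _ _ h h' => Finset.Subset.trans h' h,
    fun _ _ h => GCov.le h (GCov.refl rfl), fun _ _ _ hU hV => hU.down hV⟩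

/-- The de Groot dual of a stably compact formal topology is stably compact. -/
theorem StablyCompact.dual (h : StablyCompact cov le) :
    StablyCompact (GCov (DGThy cov le)) (supord : Finset (Finset S) → Finset (Finset S) → Prop) := by
  have hft := GCov_isFormalTopology (DGThy cov le)
  have hbc := hft.1
  have hcont : ∀ A, GCov (DGThy cov le) A {B | wb (GCov (DGThy cov le)) B A} := fun A =>
    (dualCov_approx A).mono fun A' hA' => dual_wb h hA'
  refine ⟨hft, hcont, ?_, ?_⟩
  · intro W hW
    obtain ⟨W₀, hW₀, hc⟩ := dual_wb h (A := ∅) (A' := ∅) (by simp) W (hW ∅ trivial)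
    exact ⟨W₀, hW₀, fun A _ => GCov.le (Finset.empty_subset A) hc⟩
  · intro A A' B B' hA hB
    obtain ⟨E, hE, hAE⟩ := hA _ (dualCov_approx A')
    obtain ⟨F, hF, hBF⟩ := hB _ (dualCov_approx B')
    refine wbS_of_approx hbc (E := (E ×ˢ F).image fun x => x.1 ∪ x.2) ?_ ?_
    · rintro C ⟨_, rfl, _, rfl, hCA, hCB⟩
      refine GCov_trans ((GCov.le hCA hAE).down (GCov.le hCB hBF)) ?_
      rintro D ⟨e, he, f, hf, hDe, hDf⟩
      refine GCov.le (Finset.union_subset hDe hDf) (GCov.refl ?_)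
      exact Finset.mem_coe.2 (Finset.mem_image.2 ⟨(e, f), Finset.mem_product.2 ⟨he, hf⟩, rfl⟩)
    · intro G hG
      obtain ⟨⟨e, f⟩, hef, rfl⟩ := Finset.mem_image.1 hG
      obtain ⟨he, hf⟩ := Finset.mem_product.1 hef
      refine ⟨A' ∪ B', ⟨A', rfl, B', rfl, Finset.subset_union_left, Finset.subset_union_right⟩,
        dual_wb h fun C hC => ?_⟩
      rcases Finset.mem_union.1 hC with hC | hC
      · obtain ⟨C', hC', hCC⟩ := hE he C hC
        exact ⟨C', Finset.mem_union_left _ hC', hCC⟩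
      · obtain ⟨C', hC', hCC⟩ := hF hf C hC
        exact ⟨C', Finset.mem_union_right _ hC', hCC⟩

/-- The point of the de Groot dual corresponding to a point. -/
def dualPt (cov : S → Set S → Prop) (p : Set S) : Set (Finset (Finset S)) :=
  {𝔅 | ↑𝔅 ⊆ avoid cov p}

theorem Model.isPt {P : Type*} {T : Finset P → Set (Finset P) → Prop} {m : Set P}
    (hm : Model T m) : IsPt (GCov T) supord {A : Finset P | ↑A ⊆ m} := by
  refine ⟨⟨∅, by simp⟩, ?_, fun A hA U hU => hU.sound hm hA⟩
  intro A hA B hB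
  refine ⟨A ∪ B, ⟨A, rfl, B, rfl, Finset.subset_union_left, Finset.subset_union_right⟩, ?_⟩
  rw [Set.mem_ofPred_eq, Finset.coe_union]
  exact Set.union_subset hA hB

theorem dualPt_isPt (h : StablyCompact cov le) {p : Set S} (hp : IsPt cov le p) :
    IsPt (GCov (DGThy cov le)) supord (dualPt cov p) :=
  (avoid_isModel h hp).isPt

theorem IsPt.mem_iff_singletons {P : Type*} {T : Finset P → Set (Finset P) → Prop}
    {p : Set (Finset P)} (hp : IsPt (GCov T) supord p) {A : Finset P} :
    A ∈ p ↔ ∀ g ∈ A, {g} ∈ p := by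
  have hft := GCov_isFormalTopology T
  refine ⟨fun hA g hg => hp.of_le hft (Finset.singleton_subset_iff.2 hg) hA, fun hA => ?_⟩
  obtain ⟨C, hC, hle⟩ := hp.exists_lower_bound hft A (fun g => {g}) hA
  exact hp.of_le hft (fun g hg => Finset.singleton_subset_iff.1 (hle g hg)) hC

theorem IsPt.model {P : Type*} {T : Finset P → Set (Finset P) → Prop}
    {p : Set (Finset P)} (hp : IsPt (GCov T) supord p) : Model T {g | {g} ∈ p} := by
  intro A 𝒞 hT hA
  obtain ⟨B, hB, hBp⟩ := hp.split A (hp.mem_iff_singletons.2 fun g hg => hA hg) 𝒞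
    (GCov.of_rule hT)
  exact ⟨B, hB, fun g hg => hp.mem_iff_singletons.1 hBp g hg⟩

theorem exists_pt_of_dual (h : StablyCompact cov le) {P : Set (Finset (Finset S))}
    (hP : IsPt (GCov (DGThy cov le)) supord P) : ∃ p, IsPt cov le p ∧ P = dualPt cov p := by
  have hm := hP.model
  have hfm := hm.finCons
  refine ⟨_, dualRoundedPt_isPt h hfm, ?_⟩
  have heq : avoid cov (dualRoundedPt cov {A | {A} ∈ P}) = {A | {A} ∈ P} := by
    refine (avoid_dualRoundedPt_subset h hfm).antisymm fun A hA => ?_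
    obtain ⟨_, ⟨C, hC, -, rfl⟩, hCm⟩ := hm _ _ (DGThy.L3 A A) (by
      rw [Finset.pair_eq_singleton, Finset.coe_singleton, Set.singleton_subset_iff]
      exact hA)
    exact mem_avoid_dualRoundedPt h hfm hC (hCm (by simp))
  ext 𝔅
  rw [dualPt, heq]
  exact hP.mem_iff_singletons

end Dual

/-! ### The isomorphism -/

/-- Two formal topologies with enough points are isomorphic as soon as they have the same points
and the same opens. -/
theorem isIso_of_points {X α β : Type*} {cov : α → Set α → Prop} {le : α → α → Prop}
    {cov' : β → Set β → Prop} {le' : β → β → Prop} (sat : X → α → Prop) (sat' : X → β → Prop)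
    (hcov : ∀ a U, cov a U ↔ ∀ x, sat x a → ∃ b ∈ U, sat x b)
    (hcov' : ∀ a U, cov' a U ↔ ∀ x, sat' x a → ∃ b ∈ U, sat' x b)
    (hne : ∀ x, ∃ a, sat x a) (hne' : ∀ x, ∃ b, sat' x b)
    (hle : ∀ x a b, le a b → sat x a → sat x b)
    (hle' : ∀ x a b, le' a b → sat' x a → sat' x b)
    (hdown : ∀ x a b, sat x a → sat x b → ∃ c ∈ down le {a} {b}, sat x c)
    (hdown' : ∀ x a b, sat' x a → sat' x b → ∃ c ∈ down le' {a} {b}, sat' x c)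
    (hop : ∀ x b, sat' x b → ∃ a, sat x a ∧ ∀ y, sat y a → sat' y b)
    (hop' : ∀ x a, sat x a → ∃ b, sat' x b ∧ ∀ y, sat' y b → sat y a) :
    IsIso cov le cov' le' := by
  refine ⟨fun a b => ∀ x, sat x a → sat' x b, fun b a => ∀ x, sat' x b → sat x a,
    ⟨?_, ?_, ?_⟩, ⟨?_, ?_, ?_⟩, ⟨?_, ?_⟩, ⟨?_, ?_⟩⟩
  · rintro b U hU a ⟨_, rfl, hab⟩
    refine (hcov _ _).2 fun x hx => ?_
    obtain ⟨u, hu, hxu⟩ := (hcov' _ _).1 hU x (hab x hx)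
    obtain ⟨c, hxc, hc⟩ := hop x u hxu
    exact ⟨c, ⟨u, hu, hc⟩, hxc⟩
  · refine fun a _ => (hcov _ _).2 fun x _ => ?_
    obtain ⟨b, hb⟩ := hne' x
    obtain ⟨c, hxc, hc⟩ := hop x b hb
    exact ⟨c, ⟨b, trivial, hc⟩, hxc⟩
  · rintro b₁ b₂ c ⟨a₁, ⟨_, rfl, h₁⟩, a₂, ⟨_, rfl, h₂⟩, hc₁, hc₂⟩
    refine (hcov _ _).2 fun x hx => ?_
    obtain ⟨d, hd, hxd⟩ := hdown' x _ _ (h₁ x (hle x _ _ hc₁ hx)) (h₂ x (hle x _ _ hc₂ hx))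
    obtain ⟨e, hxe, he⟩ := hop x d hxd
    exact ⟨e, ⟨d, hd, he⟩, hxe⟩
  · rintro b U hU a ⟨_, rfl, hab⟩
    refine (hcov' _ _).2 fun x hx => ?_
    obtain ⟨u, hu, hxu⟩ := (hcov _ _).1 hU x (hab x hx)
    obtain ⟨c, hxc, hc⟩ := hop' x u hxu
    exact ⟨c, ⟨u, hu, hc⟩, hxc⟩
  · refine fun a _ => (hcov' _ _).2 fun x _ => ?_
    obtain ⟨b, hb⟩ := hne x
    obtain ⟨c, hxc, hc⟩ := hop' x b hb
    exact ⟨c, ⟨b, trivial, hc⟩, hxc⟩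
  · rintro b₁ b₂ c ⟨a₁, ⟨_, rfl, h₁⟩, a₂, ⟨_, rfl, h₂⟩, hc₁, hc₂⟩
    refine (hcov' _ _).2 fun x hx => ?_
    obtain ⟨d, hd, hxd⟩ := hdown x _ _ (h₁ x (hle' x _ _ hc₁ hx)) (h₂ x (hle' x _ _ hc₂ hx))
    obtain ⟨e, hxe, he⟩ := hop' x d hxd
    exact ⟨e, ⟨d, hd, he⟩, hxe⟩
  · rintro c a ⟨_, rfl, b, hab, hbc⟩
    exact (hcov _ _).2 fun x hx => ⟨_, ⟨_, rfl, rfl⟩, hbc x (hab x hx)⟩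
  · rintro c a ⟨_, rfl, rfl⟩
    refine (hcov _ _).2 fun x hx => ?_
    obtain ⟨b, hxb, hb⟩ := hop' x _ hx
    obtain ⟨d, hxd, hd⟩ := hop x b hxb
    exact ⟨d, ⟨_, rfl, b, hd, hb⟩, hxd⟩
  · rintro c a ⟨_, rfl, b, hab, hbc⟩
    exact (hcov' _ _).2 fun x hx => ⟨_, ⟨_, rfl, rfl⟩, hbc x (hab x hx)⟩
  · rintro c a ⟨_, rfl, rfl⟩
    refine (hcov' _ _).2 fun x hx => ?_
    obtain ⟨b, hxb, hb⟩ := hop x _ hx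
    obtain ⟨d, hxd, hd⟩ := hop' x b hxb
    exact ⟨d, ⟨_, rfl, b, hd, hb⟩, hxd⟩

section Opens

variable {S : Type*} {cov : S → Set S → Prop} {le : S → S → Prop}

theorem dual_generator_open (h : StablyCompact cov le) {p : Set S} (hp : IsPt cov le p)
    {g : PatchGen (Finset (Finset S))}
    (hg : g ∈ patchModel (GCov (DGThy cov le)) (dualPt cov p)) :
    ∃ A : Finset (PatchGen S), ↑A ⊆ patchModel cov p ∧ ∀ q, IsPt cov le q →
      ↑A ⊆ patchModel cov q → g ∈ patchModel (GCov (DGThy cov le)) (dualPt cov q) := by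
  have hd := h.dual
  have hdbc := hd.ft.1
  cases g with
  | r 𝔅 =>
    have hiff : ∀ q : Set S, (↑(𝔅.image PatchGen.l) : Set (PatchGen S)) ⊆ patchModel cov q ↔
        𝔅 ∈ dualPt cov q := by
      intro q
      rw [Finset.coe_image, Set.image_subset_iff]
      rfl
    exact ⟨_, (hiff p).2 hg, fun q _ hq => (hiff q).1 hq⟩
  | l 𝒜 =>
    obtain ⟨𝒞, h𝒜𝒞, h𝒞⟩ : 𝒜 ∈ avoid (GCov (DGThy cov le)) (dualPt cov p) := hg
    have hex : ∀ 𝔅 ∈ 𝒞, ∃ A ∈ 𝔅, A ∉ avoid cov p := fun 𝔅 h𝔅 => Set.not_subset.1 (h𝒞 𝔅 h𝔅)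
    obtain ⟨G, h𝒜G, hG⟩ := h𝒜𝒞.exists_between hdbc hd.cont
    obtain ⟨W, hW, hGW⟩ := hG {w | ∃ A : Finset S, w = {A} ∧ ∃ a ∈ A, a ∈ p} (by
      intro 𝔅 h𝔅
      obtain ⟨A, hA, hAp⟩ := hex 𝔅 h𝔅
      refine GCov.le (Finset.singleton_subset_iff.2 hA) ?_
      have := GCov.of_rule (DGThy.L3 (cov := cov) (le := le) A A)
      rw [Finset.pair_eq_singleton] at this
      refine this.mono ?_
      rintro _ ⟨A', hAA', -, rfl⟩
      refine ⟨A', rfl, ?_⟩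
      by_contra! hno
      exact hAp ⟨A', hAA', hno⟩)
    have hW' : ∀ w ∈ W, ∃ a ∈ p, ∃ A : Finset S, A ∈ w ∧ a ∈ A := by
      intro w hw
      obtain ⟨A, rfl, a, ha, hap⟩ := hW hw
      exact ⟨a, hap, A, by simp, ha⟩
    have : Nonempty S := hp.nonempty.to_type
    choose! f hf F hF hfF using hW'
    obtain ⟨c, hc, hcle⟩ := hp.exists_lower_bound h.ft W f hf
    refine ⟨{PatchGen.r c}, by simpa using hc, fun q hq hcq => ?_⟩
    have hcq' : c ∈ q := hcq (a := PatchGen.r c) (by simp)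
    refine ⟨W, h𝒜G.mono hdbc (covS.refl hdbc subset_rfl) hGW, fun w hw hwq => ?_⟩
    exact not_mem_avoid h.ft.1 hq (hfF w hw) (hq.of_le h.ft (hcle w hw) hcq') (hwq (hF w hw))

theorem generator_open_dual (h : StablyCompact cov le) {p : Set S} (hp : IsPt cov le p)
    {g : PatchGen S} (hg : g ∈ patchModel cov p) :
    ∃ B : Finset (PatchGen (Finset (Finset S))),
      ↑B ⊆ patchModel (GCov (DGThy cov le)) (dualPt cov p) ∧ ∀ q, IsPt cov le q →
      ↑B ⊆ patchModel (GCov (DGThy cov le)) (dualPt cov q) → g ∈ patchModel cov q := by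
  have hbc := h.ft.1
  cases g with
  | r a =>
    obtain ⟨b, hba, hb⟩ := hp.split a hg _ (h.cont a)
    obtain ⟨c, hcb, hc⟩ := hp.split b hb _ (h.cont b)
    refine ⟨{PatchGen.l {{{b}}}}, ?_, fun q hq hbq => ?_⟩
    · rw [Finset.coe_singleton, Set.singleton_subset_iff]
      refine ⟨{{{c}}}, ?_, ?_⟩
      · rw [Finset.coe_singleton, Finset.coe_singleton, wbS_singleton]
        refine dual_wb h ?_
        simpa using wbS_singleton.2 hcb
      · intro 𝔅 h𝔅 hmem
        rw [Finset.mem_singleton.1 h𝔅] at hmem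
        exact not_mem_avoid hbc hp (Finset.mem_singleton_self c) hc (hmem (by simp))
    · by_contra haq
      have hl : {{{b}}} ∈ avoid (GCov (DGThy cov le)) (dualPt cov q) :=
        l_mem_patchModel.1 (hbq (Finset.mem_coe.2 (Finset.mem_singleton_self _)))
      refine not_mem_avoid h.dual.ft.1 (dualPt_isPt h hq) (Finset.mem_singleton_self _) ?_ hl
      intro A hA
      have hA' : A = {b} := by simpa using hA
      subst hA'
      exact ⟨{a}, by simpa using wbS_singleton.2 hba, by simpa using haq⟩
  | l A =>
    have hiff : ∀ q : Set S, {A} ∈ dualPt cov q ↔ A ∈ avoid cov q := by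
      intro q
      rw [dualPt, Set.mem_ofPred_eq, Finset.coe_singleton, Set.singleton_subset_iff]
    refine ⟨{PatchGen.r {A}}, ?_, fun q _ hAq => ?_⟩
    · rw [Finset.coe_singleton, Set.singleton_subset_iff]
      exact (hiff p).2 hg
    · exact (hiff q).1 (hAq (a := PatchGen.r {A}) (by simp))

end Opens

/-- If every generator true at a point contains a basic neighbourhood of that point, then so does
every finite conjunction of generators. -/
theorem exists_finset_open {X P Q : Type*} {m : X → Set P} {n : X → Set Q}
    (h : ∀ x, ∀ g ∈ n x, ∃ A : Finset P, ↑A ⊆ m x ∧ ∀ y, ↑A ⊆ m y → g ∈ n y)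
    (x : X) (B : Finset Q) (hB : ↑B ⊆ n x) :
    ∃ A : Finset P, ↑A ⊆ m x ∧ ∀ y, ↑A ⊆ m y → ↑B ⊆ n y := by
  have h' : ∀ g ∈ B, ∃ A : Finset P, ↑A ⊆ m x ∧ ∀ y, ↑A ⊆ m y → g ∈ n y :=
    fun g hg => h x g (hB hg)
  choose! f hf hfn using h'
  refine ⟨B.biUnion f, ?_, fun y hy g hg => hfn g hg y ?_⟩
  · rw [Finset.coe_biUnion]
    exact Set.iUnion₂_subset hf
  · exact (Finset.coe_subset.2 (Finset.subset_biUnion_of_mem f hg)).trans hy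


/-- For any stably compact formal topology `S`,
`Patch(S) ≅ Patch(S^d)`, where `S^d` is the de Groot dual presented by the
geometric theory `T^d`. -/
theorem patch_iso_patch_deGroot {S : Type u}
    (cov : S → Set S → Prop) (le : S → S → Prop)
    (hft : IsFormalTopology cov le) (w : S → Set S) (hw : IsContinuous cov w)
    (hcomp : Compact cov) (hst : Stable cov le) :
    IsIso (patchCov cov le) (supord : Finset (PatchGen S) → Finset (PatchGen S) → Prop)
      (patchCov (GCov (DGThy cov le)) (supord : Finset (Finset S) → Finset (Finset S) → Prop))
      (supord : Finset (PatchGen (Finset (Finset S))) → Finset (PatchGen (Finset (Finset S))) → Prop) := by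
  have h : StablyCompact cov le :=
    ⟨hft, fun a => hft.1.2 _ _ _ (hw.2 a) fun b hb => hft.1.1 _ _ (hw.1 a b hb), hcomp, hst⟩
  have hdown : ∀ {P : Type u} {m : Set P} (A B : Finset P), (↑A : Set P) ⊆ m → (↑B : Set P) ⊆ m →
      ∃ C ∈ down supord {A} {B}, (↑C : Set P) ⊆ m := fun A B hA hB =>
    ⟨A ∪ B, ⟨A, rfl, B, rfl, Finset.subset_union_left, Finset.subset_union_right⟩, by
      rw [Finset.coe_union]
      exact Set.union_subset hA hB⟩
  let X := {p : Set S // IsPt cov le p}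
  let m : X → Set (PatchGen S) := fun p => patchModel cov p.1
  let n : X → Set (PatchGen (Finset (Finset S))) :=
    fun p => patchModel (GCov (DGThy cov le)) (dualPt cov p.1)
  refine isIso_of_points (fun p A => (↑A : Set _) ⊆ m p) (fun p B => (↑B : Set _) ⊆ n p)
    ?_ ?_ (fun _ => ⟨∅, by simp⟩) (fun _ => ⟨∅, by simp⟩)
    (fun _ _ _ hle hA => (Finset.coe_subset.2 hle).trans hA)
    (fun _ _ _ hle hA => (Finset.coe_subset.2 hle).trans hA)
    (fun _ A B => hdown A B) (fun _ A B => hdown A B) ?_ ?_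
  · exact fun A U => (patchCov_iff h).trans ⟨fun H p => H p.1 p.2, fun H p hp => H ⟨p, hp⟩⟩
  · refine fun A U => (patchCov_iff h.dual).trans
      ⟨fun H p => H _ (dualPt_isPt h p.2), fun H P hP => ?_⟩
    obtain ⟨p, hp, rfl⟩ := exists_pt_of_dual h hP
    exact H ⟨p, hp⟩
  · refine exists_finset_open fun p g hg => ?_
    obtain ⟨A, hA, hq⟩ := dual_generator_open h p.2 hg
    exact ⟨A, hA, fun q => hq q.1 q.2⟩
  · refine exists_finset_open fun p g hg => ?_
    obtain ⟨B, hB, hq⟩ := generator_open_dual h p.2 hg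
    exact ⟨B, hB, fun q => hq q.1 q.2⟩

end FTP
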